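/- Let p ≥ 2 and let a, b, c : ℤ → ℝ be p-periodic sequences. Let J be the bounded linear operator on ℓ²(ℤ) defined by (Ju)_n = c_{n−1}u_{n−1} + a_n u_n + b_n u_{n+1}. If for some ε > 0 the ε-pseudospectrum Λ_ε(J) is path-connected, then ω_a ≤ 2(ε + max_{0≤i≤p−1}|c_i − b_i|)(p − 1). -/

import Mathlib

/-- The `ε`-pseudospectrum of an element `a` of a complex normed algebra:
the set of `z ∈ ℂ` such that `z - a` is not invertible or `‖(z - a)⁻¹‖ ≥ ε⁻¹`. -/
noncomputable def pseudospectrum {A : Type*} [NormedRing A] [NormedAlgebra ℂ A]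
    (ε : ℝ) (a : A) : Set ℂ :=
  {z : ℂ | z ∈ spectrum ℂ a ∨ ε⁻¹ ≤ ‖Ring.inverse (algebraMap ℂ A z - a)‖}

/-- The oscillation `ω_v = max { |v i - v j| : 0 ≤ i, j ≤ p-1 }` of a `p`-periodic
real sequence `v`. -/
noncomputable def osc (p : ℕ) (v : ℤ → ℝ) : ℝ :=
  ⨆ i : Fin p, ⨆ j : Fin p, |v ((i : ℕ) : ℤ) - v ((j : ℕ) : ℤ)|

open scoped InnerProductSpace

section Accretive
variable {E : Type*} [NormedAddCommGroup E] [InnerProductSpace ℂ E]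

lemma mul_norm_le_of_inner_coercive {S N : E →L[ℂ] E} (hS1 : ‖S‖ ≤ 1) {c : ℝ}
    (h : ∀ u, c * ‖u‖ ^ 2 ≤ (⟪S u, N u⟫_ℂ).re) (u : E) : c * ‖u‖ ≤ ‖N u‖ := by
  rcases (norm_nonneg u).eq_or_lt with h0 | h0
  · rw [← h0]; simp
  · have h1 : c * ‖u‖ ^ 2 ≤ ‖u‖ * ‖N u‖ := by
      refine (h u).trans ((Complex.re_le_norm _).trans ((norm_inner_le_norm _ _).trans ?_))
      gcongr
      simpa using S.le_of_opNorm_le hS1 u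
    have : ‖u‖ * (c * ‖u‖) ≤ ‖u‖ * ‖N u‖ := by linarith
    exact le_of_mul_le_mul_left this h0

variable [CompleteSpace E]

lemma isUnit_of_inner_coercive {S N : E →L[ℂ] E} (hS : IsSelfAdjoint S) {c : ℝ} (hc : 0 < c)
    (h : ∀ u, c * ‖u‖ ^ 2 ≤ (⟪S u, N u⟫_ℂ).re) : IsUnit N := by
  have hadj : ∀ u v, ⟪S u, v⟫_ℂ = ⟪u, S v⟫_ℂ := fun u v => hS.isSymmetric u v
  have hB : IsUnit (S * N) := by
    refine ContinuousLinearMap.isUnit_of_forall_le_norm_inner_map _ (c := ⟨c, hc.le⟩) hc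
      fun u => ?_
    calc ‖u‖ ^ 2 * c ≤ (⟪S u, N u⟫_ℂ).re := by linarith [h u]
      _ = (⟪u, (S * N) u⟫_ℂ).re := by rw [hadj]; rfl
      _ ≤ ‖⟪u, (S * N) u⟫_ℂ‖ := Complex.re_le_norm _
      _ = ‖⟪(S * N) u, u⟫_ℂ‖ := norm_inner_symm _ _
  have hB' : IsUnit (star N * S) := by
    have := hB.star
    rwa [star_mul, hS.star_eq] at this
  have hSu : IsUnit S := by
    obtain ⟨x, hx⟩ := hB.exists_right_inv
    obtain ⟨y, hy⟩ := hB'.exists_left_inv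
    exact isUnit_iff_exists_and_exists.2 ⟨⟨N * x, by rw [← mul_assoc, hx]⟩,
      ⟨y * star N, by rw [mul_assoc, hy]⟩⟩
  obtain ⟨s, rfl⟩ := hSu
  exact (Units.isUnit_units_mul s N).1 hB

lemma spectralRadius_one_add_smul_lt_one {A : Type*} [NormedRing A] [NormedAlgebra ℂ A]
    [CompleteSpace A] [NormOneClass A] [Nontrivial A] {N : A}
    (hN : ∀ z ∈ spectrum ℂ N, z.re < 0) {h₀ : ℝ} (hh₀ : 0 < h₀) :
    ∃ h : ℝ, 0 < h ∧ h ≤ h₀ ∧ spectralRadius ℂ (1 + (h : ℂ) • N) < 1 := by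
  obtain ⟨w, hw, hmax⟩ := (spectrum.isCompact N).exists_isMaxOn (spectrum.nonempty N)
    Complex.continuous_re.continuousOn
  have hw0 := hN w hw
  set d := -w.re with hd
  have hd0 : 0 < d := by linarith
  set M := ‖N‖ ^ 2 + 1 with hM
  have hM0 : 0 < M := by positivity
  refine ⟨min h₀ (d / M), lt_min hh₀ (by positivity), min_le_left _ _, ?_⟩
  set h := min h₀ (d / M) with hh
  have hpos : 0 < h := lt_min hh₀ (by positivity)
  have hhM : h * M ≤ d := by
    rw [← le_div_iff₀ hM0]; exact min_le_right _ _
  have := spectrum.spectralRadius_lt_of_forall_lt (1 + (h : ℂ) • N) (r := 1) ?_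
  · simpa using this
  · intro k hk
    have hne : (h : ℂ) ≠ 0 := by exact_mod_cast hpos.ne'
    obtain ⟨z, hz, rfl⟩ : ∃ z ∈ spectrum ℂ N, 1 + (h : ℂ) * z = k := by
      refine ⟨(k - 1) / h, ?_, by field_simp; ring⟩
      have h1 : k - 1 ∈ spectrum ℂ ((h : ℂ) • N) := by
        rw [← spectrum.add_mem_add_iff (s := (1 : ℂ))]
        simpa [add_comm] using hk
      rw [← spectrum.smul_mem_smul_iff (r := Units.mk0 (h : ℂ) hne)]
      simpa [Units.smul_def, mul_div_cancel₀ _ hne] using h1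
    have hzr : z.re ≤ -d := by simpa [hd] using hmax hz
    have hzn : ‖z‖ ≤ ‖N‖ := spectrum.norm_le_norm_of_mem hz
    have hsq : ‖1 + (h : ℂ) * z‖ ^ 2 < 1 := by
      have e : ‖1 + (h : ℂ) * z‖ ^ 2 = 1 + 2 * h * z.re + h ^ 2 * ‖z‖ ^ 2 := by
        rw [Complex.sq_norm, Complex.sq_norm, Complex.normSq_apply, Complex.normSq_apply]
        simp
        ring
      have h2 : ‖z‖ ^ 2 ≤ M := by
        have : ‖z‖ ^ 2 ≤ ‖N‖ ^ 2 := by gcongr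
        linarith
      have h3 : h ^ 2 * ‖z‖ ^ 2 ≤ h * d := by
        calc h ^ 2 * ‖z‖ ^ 2 ≤ h ^ 2 * M := by gcongr
          _ = h * (h * M) := by ring
          _ ≤ h * d := by gcongr
      have h4 : h * z.re ≤ h * -d := by gcongr
      have h5 : 0 < h * d := by positivity
      rw [e]; linarith
    have : ‖1 + (h : ℂ) * z‖ < 1 := by
      have := abs_lt_of_sq_lt_sq (a := ‖1 + (h : ℂ) * z‖) (b := 1) (by simpa using hsq) zero_le_one
      exact (abs_lt.1 this).2
    exact_mod_cast this

lemma tendsto_norm_pow_of_spectralRadius_lt_one {A : Type*} [NormedRing A] [NormedAlgebra ℂ A]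
    [CompleteSpace A] {a : A} (ha : spectralRadius ℂ a < 1) :
    Filter.Tendsto (fun n => ‖a ^ n‖) Filter.atTop (nhds 0) := by
  obtain ⟨r, hr, hr1⟩ := exists_between ha
  lift r to NNReal using (hr1.trans ENNReal.one_lt_top).ne
  have hr1' : r < 1 := by exact_mod_cast hr1
  have h := (spectrum.pow_nnnorm_pow_one_div_tendsto_nhds_spectralRadius a).eventually_lt_const hr
  refine squeeze_zero' (Filter.Eventually.of_forall fun _ => norm_nonneg _) ?_
    (tendsto_pow_atTop_nhds_zero_of_lt_one (r := (r : ℝ)) r.2 (by exact_mod_cast hr1'))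
  filter_upwards [h, Filter.eventually_gt_atTop 0] with n hn hn0
  have hn0' : (n : ℝ) ≠ 0 := by positivity
  have h2 := ENNReal.rpow_le_rpow hn.le (z := (n : ℝ)) (by positivity)
  rw [← ENNReal.rpow_mul, one_div_mul_cancel hn0', ENNReal.rpow_one, ENNReal.rpow_natCast] at h2
  exact_mod_cast h2

/-- Discrete form of Lyapunov's theorem: if `S N` is strictly accretive and the spectrum of `N` lies
in the open left half-plane, then the quadratic form of `S` is nonpositive. -/
lemma re_inner_nonpos_of_spectrum_re_neg {S N : E →L[ℂ] E} (hS : IsSelfAdjoint S) (hS1 : ‖S‖ ≤ 1)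
    {c : ℝ} (hc : 0 < c) (h : ∀ u, c * ‖u‖ ^ 2 ≤ (⟪S u, N u⟫_ℂ).re)
    (hN : ∀ z ∈ spectrum ℂ N, z.re < 0) (u : E) : (⟪S u, u⟫_ℂ).re ≤ 0 := by
  rcases subsingleton_or_nontrivial E with hE | hE
  · simp [Subsingleton.elim u 0]
  have hadj : ∀ u v, ⟪S u, v⟫_ℂ = ⟪u, S v⟫_ℂ := fun u v => hS.isSymmetric u v
  have hSn : ∀ v, ‖S v‖ ≤ ‖v‖ := fun v => by simpa using S.le_of_opNorm_le hS1 v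
  obtain ⟨t, ht0, htle, ht⟩ := spectralRadius_one_add_smul_lt_one hN
    (h₀ := 2 * c / (‖N‖ ^ 2 + 1)) (by positivity)
  set T := 1 + (t : ℂ) • N with hT
  have hstep : ∀ v, (⟪S v, v⟫_ℂ).re ≤ (⟪S (T v), T v⟫_ℂ).re := by
    intro v
    have e : (⟪S (T v), T v⟫_ℂ).re = (⟪S v, v⟫_ℂ).re + 2 * t * (⟪S v, N v⟫_ℂ).re
        + t ^ 2 * (⟪S (N v), N v⟫_ℂ).re := by
      have e1 : T v = v + (t : ℂ) • N v := by simp [hT]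
      have e2 : (⟪S (N v), v⟫_ℂ).re = (⟪S v, N v⟫_ℂ).re := by
        rw [hadj, ← inner_conj_symm, Complex.conj_re]
      rw [e1]
      simp only [map_add, map_smul, inner_add_left, inner_add_right, inner_smul_left,
        inner_smul_right, Complex.conj_ofReal, Complex.add_re, Complex.re_ofReal_mul, e2]
      ring
    have h1 : -(‖N‖ ^ 2 * ‖v‖ ^ 2) ≤ (⟪S (N v), N v⟫_ℂ).re := by
      have h2 : |(⟪S (N v), N v⟫_ℂ).re| ≤ ‖N v‖ * ‖N v‖ :=
        (Complex.abs_re_le_norm _).trans ((norm_inner_le_norm _ _).trans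
          (by gcongr; exact hSn _))
      have h3 : ‖N v‖ * ‖N v‖ ≤ (‖N‖ * ‖v‖) * (‖N‖ * ‖v‖) := by
        gcongr <;> exact N.le_opNorm v
      have := (abs_le.1 h2).1
      linarith
    have h4 : t * (‖N‖ ^ 2 + 1) ≤ 2 * c := by rwa [← le_div_iff₀ (by positivity)]
    have h5 : 0 ≤ t * (2 * c - t * ‖N‖ ^ 2) * ‖v‖ ^ 2 := by
      have : 0 ≤ 2 * c - t * ‖N‖ ^ 2 := by linarith
      positivity
    have h6 : t ^ 2 * -(‖N‖ ^ 2 * ‖v‖ ^ 2) ≤ t ^ 2 * (⟪S (N v), N v⟫_ℂ).re := by gcongr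
    have h7 : 2 * t * (c * ‖v‖ ^ 2) ≤ 2 * t * (⟪S v, N v⟫_ℂ).re := by
      gcongr
      exact h v
    rw [e]; linarith
  have hpow : ∀ n : ℕ, (⟪S u, u⟫_ℂ).re ≤ (⟪S ((T ^ n) u), (T ^ n) u⟫_ℂ).re := by
    intro n
    induction n with
    | zero => simp
    | succ n ih =>
      rw [pow_succ']
      exact ih.trans (hstep _)
  have hlim := tendsto_norm_pow_of_spectralRadius_lt_one ht
  have hlim2 : Filter.Tendsto (fun n => (‖T ^ n‖ * ‖u‖) ^ 2) Filter.atTop (nhds 0) := by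
    simpa using (hlim.mul_const ‖u‖).pow 2
  refine ge_of_tendsto' hlim2 fun n => (hpow n).trans ?_
  refine (Complex.re_le_norm _).trans ((norm_inner_le_norm _ _).trans ?_)
  rw [sq]
  gcongr
  · exact (hSn _).trans ((T ^ n).le_opNorm u)
  · exact (T ^ n).le_opNorm u

/-- A self-adjoint operator bounded below by `g` in norm admits a bounded sign. -/
lemma exists_selfAdjoint_sign {T : E →L[ℂ] E} (hT : IsSelfAdjoint T) {g : ℝ} (hg : 0 < g)
    (h : ∀ u, g * ‖u‖ ≤ ‖T u‖) : ∃ S : E →L[ℂ] E, IsSelfAdjoint S ∧ ‖S‖ ≤ 1 ∧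
      (∀ u, g * ‖u‖ ^ 2 ≤ (⟪S u, T u⟫_ℂ).re) ∧
      ((∀ u, (⟪S u, u⟫_ℂ).re ≤ 0) → ∀ u, (⟪T u, u⟫_ℂ).re ≤ 0) ∧
      ((∀ u, 0 ≤ (⟪S u, u⟫_ℂ).re) → ∀ u, 0 ≤ (⟪T u, u⟫_ℂ).re) := by
  have hpos : ∀ {A : E →L[ℂ] E}, IsSelfAdjoint A → (0 ≤ A ↔ ∀ u, 0 ≤ (⟪A u, u⟫_ℂ).re) := by
    intro A hA
    rw [ContinuousLinearMap.nonneg_iff_isPositive, ContinuousLinearMap.isPositive_def']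
    exact ⟨fun h => h.2, fun h => ⟨hA, h⟩⟩
  have hself : ∀ v : E, ⟪v, v⟫_ℂ = ((‖v‖ ^ 2 : ℝ) : ℂ) := fun v => by
    rw [inner_self_eq_norm_sq_to_K]; norm_cast
  have hspec : ∀ t ∈ spectrum ℝ T, g ≤ |t| := by
    have h0 : 0 ≤ cfc (fun t : ℝ => t ^ 2 - g ^ 2) T := by
      rw [hpos (cfc_predicate _ _)]
      intro u
      rw [cfc_sub (fun t : ℝ => t ^ 2) (fun _ => g ^ 2) T, cfc_pow_id (R := ℝ) T 2,
        cfc_const (g ^ 2) T]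
      have e : ⟪T (T u), u⟫_ℂ = ⟪T u, T u⟫_ℂ := hT.isSymmetric _ _
      have e1 : (T ^ 2 - algebraMap ℝ (E →L[ℂ] E) (g ^ 2)) u
          = T (T u) - ((g ^ 2 : ℝ) : ℂ) • u := by
        rw [Algebra.algebraMap_eq_smul_one]
        simp [sq, mul_smul]
      have h1 := h u
      have h2 : (g * ‖u‖) ^ 2 ≤ ‖T u‖ ^ 2 := by gcongr
      rw [e1, inner_sub_left, e, inner_smul_left, hself, hself, Complex.conj_ofReal,
        Complex.sub_re, Complex.re_ofReal_mul, Complex.ofReal_re, Complex.ofReal_re]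
      linarith
    rw [cfc_nonneg_iff (fun t : ℝ => t ^ 2 - g ^ 2) T] at h0
    intro t ht
    have := h0 t ht
    exact abs_le_of_sq_le_sq' (by simp at this ⊢; linarith) (abs_nonneg t) |>.2
  obtain ⟨f, hf, hf1, hfpos, hfneg, hfmul⟩ : ∃ f : ℝ → ℝ, Continuous f ∧ (∀ t, |f t| ≤ 1) ∧
      (∀ t, 0 < t → 0 < f t) ∧ (∀ t, t < 0 → f t < 0) ∧ ∀ t, g ≤ |t| → f t * t = |t| := by
    refine ⟨fun t => max (-1) (min 1 (t / g)), by fun_prop, fun t => ?_, fun t ht => ?_,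
      fun t ht => ?_, fun t ht => ?_⟩
    · exact abs_le.2 ⟨le_max_left _ _, max_le (by norm_num) (min_le_left _ _)⟩
    · exact lt_max_of_lt_right (lt_min one_pos (by positivity))
    · exact max_lt (by norm_num) (min_lt_of_right_lt (div_neg_of_neg_of_pos ht hg))
    · rcases le_abs'.1 ht with h2 | h2
      · have h3 : t / g ≤ -1 := by rw [div_le_iff₀ hg]; linarith
        have h4 := max_eq_left ((min_le_right 1 _).trans h3)
        simp only [h4, abs_of_neg (show t < 0 by linarith)]
        ring
      · have h3 : 1 ≤ t / g := by rw [le_div_iff₀ hg]; linarith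
        simp only [min_eq_left h3, abs_of_pos (show 0 < t by linarith)]
        norm_num
  have hSsa : IsSelfAdjoint (cfc f T) := cfc_predicate _ _
  refine ⟨cfc f T, hSsa, ?_, ?_, ?_, ?_⟩
  · refine norm_cfc_le zero_le_one fun t _ => ?_
    exact hf1 t
  · intro u
    have h0 : 0 ≤ cfc (fun t => f t * t - g) T := by
      refine cfc_nonneg fun t ht => ?_
      have h1 := hspec t ht
      rw [hfmul t h1]
      linarith
    rw [hpos (cfc_predicate _ _)] at h0
    have := h0 u
    rw [cfc_sub (fun t : ℝ => f t * t) (fun _ => g) T, cfc_mul f (fun t => t) T,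
      cfc_const g T, cfc_id' ℝ T, Algebra.algebraMap_eq_smul_one] at this
    have e1 : (cfc f T * T - g • (1 : E →L[ℂ] E)) u
          = cfc f T (T u) - ((g : ℝ) : ℂ) • u := by
      simp
    have e : ⟪cfc f T (T u), u⟫_ℂ = ⟪T u, cfc f T u⟫_ℂ := hSsa.isSymmetric _ _
    rw [e1, inner_sub_left, e, inner_smul_left, hself, ← inner_conj_symm, Complex.sub_re,
      Complex.conj_re, Complex.conj_ofReal, Complex.re_ofReal_mul, Complex.ofReal_re] at this
    linarith
  · intro hS
    have h0 : 0 ≤ cfc (fun t => - f t) T := by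
      rw [hpos (cfc_predicate _ _), cfc_neg]
      intro u
      simpa using hS u
    rw [cfc_nonneg_iff (fun t => - f t) T] at h0
    have h1 : 0 ≤ cfc (fun t : ℝ => -t) T := cfc_nonneg fun t ht => by
      by_contra! hlt
      have := h0 t ht
      have := hfpos t (by linarith)
      simp at *
      linarith
    rw [hpos (cfc_predicate _ _), cfc_neg, cfc_id' ℝ T] at h1
    intro u
    simpa using h1 u
  · intro hS
    have h0 : 0 ≤ cfc f T := (hpos hSsa).2 hS
    rw [cfc_nonneg_iff f T] at h0
    have h1 : 0 ≤ cfc (fun t : ℝ => t) T := cfc_nonneg fun t ht => by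
      by_contra! hlt
      have := h0 t ht
      have := hfneg t hlt
      simp at *
      linarith
    rw [cfc_id' ℝ T] at h1
    exact (hpos hT).1 h1

end Accretive

section Gap
variable {E : Type*} [NormedAddCommGroup E] [InnerProductSpace ℂ E] [CompleteSpace E]

lemma notMem_pseudospectrum {J : E →L[ℂ] E} {ε g : ℝ} (hε : 0 < ε) (hεg : ε < g) {z : ℂ}
    (hu : IsUnit (J - algebraMap ℂ _ z))
    (hz : ∀ u, g * ‖u‖ ≤ ‖(J - algebraMap ℂ _ z) u‖) : z ∉ pseudospectrum ε J := by
  have hg : 0 < g := hε.trans hεg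
  have hu' : IsUnit (algebraMap ℂ (E →L[ℂ] E) z - J) := by rw [← neg_sub]; exact hu.neg
  rintro (h | h)
  · exact h hu'
  · have hle : ‖Ring.inverse (algebraMap ℂ (E →L[ℂ] E) z - J)‖ ≤ g⁻¹ := by
      refine ContinuousLinearMap.opNorm_le_bound _ (by positivity) fun v => ?_
      rw [inv_mul_eq_div, le_div_iff₀' hg]
      refine (hz _).trans_eq ?_
      have := congrArg (fun A : E →L[ℂ] E => A v) (Ring.mul_inverse_cancel _ hu')
      rw [← neg_sub, neg_apply, norm_neg]
      exact congrArg norm this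
    exact absurd (h.trans hle) (not_le.2 (inv_strictAnti₀ hε hεg))

/-- If the self-adjoint operator `H` has a gap of half-width `g > ε + δ` around `x` with spectrum on
both sides, then the `ε`-pseudospectrum of a perturbation of `H` of norm at most `δ` is
disconnected. -/
lemma not_isPreconnected_pseudospectrum {H K : E →L[ℂ] E} (hH : IsSelfAdjoint H) {ε δ g x : ℝ}
    (hε : 0 < ε) (hK : ‖K‖ ≤ δ) (hg : ε + δ < g)
    (hgap : ∀ u, g * ‖u‖ ≤ ‖H u - (x : ℂ) • u‖)
    {v w : E} (hv : x * ‖v‖ ^ 2 < (⟪H v, v⟫_ℂ).re) (hw : (⟪H w, w⟫_ℂ).re < x * ‖w‖ ^ 2) :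
    ¬ IsPreconnected (pseudospectrum ε (H + K)) := by
  have hδ : 0 ≤ δ := (norm_nonneg K).trans hK
  set T : E →L[ℂ] E := H - algebraMap ℂ _ (x : ℂ) with hTdef
  have hTapp : ∀ u, T u = H u - (x : ℂ) • u := fun u => by
    simp [hTdef, Algebra.algebraMap_eq_smul_one]
  have hTin : ∀ u, (⟪T u, u⟫_ℂ).re = (⟪H u, u⟫_ℂ).re - x * ‖u‖ ^ 2 := by
    intro u
    rw [hTapp, inner_sub_left, inner_smul_left, Complex.conj_ofReal, Complex.sub_re,
      Complex.re_ofReal_mul]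
    congr 2
    exact inner_self_eq_norm_sq (𝕜 := ℂ) u
  have hT : IsSelfAdjoint T := hH.sub (by
    rw [IsSelfAdjoint, ← algebraMap_star_comm]; simp)
  obtain ⟨S, hS, hS1, hST, hSneg, hSpos⟩ := exists_selfAdjoint_sign hT (by linarith : 0 < g)
    (by simpa only [hTapp] using hgap)
  have hadj : ∀ u v, ⟪S u, v⟫_ℂ = ⟪u, S v⟫_ℂ := fun u v => hS.isSymmetric u v
  set N : E →L[ℂ] E := T + K with hN
  have hJN : ∀ z : ℂ, H + K - algebraMap ℂ _ z = N - algebraMap ℂ _ (z - x) := by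
    intro z
    rw [hN, hTdef, map_sub]
    abel
  have hcoer : ∀ y : ℝ, ∀ u, (g - δ) * ‖u‖ ^ 2 ≤
      (⟪S u, (N - algebraMap ℂ _ (y * Complex.I)) u⟫_ℂ).re := by
    intro y u
    have e : (N - algebraMap ℂ _ (y * Complex.I)) u = T u + K u - (y * Complex.I) • u := by
      simp [hN, Algebra.algebraMap_eq_smul_one]
    have him : (⟪S u, (y * Complex.I) • u⟫_ℂ).re = 0 := by
      have h1 : (⟪S u, u⟫_ℂ).im = 0 := by
        rw [← Complex.conj_eq_iff_im, inner_conj_symm, hadj]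
      rw [inner_smul_right]
      simp [h1]
    have hKu : -(δ * ‖u‖ ^ 2) ≤ (⟪S u, K u⟫_ℂ).re := by
      have h2 : |(⟪S u, K u⟫_ℂ).re| ≤ (1 * ‖u‖) * (δ * ‖u‖) :=
        (Complex.abs_re_le_norm _).trans ((norm_inner_le_norm _ _).trans
          (by gcongr; exacts [S.le_of_opNorm_le hS1 u, K.le_of_opNorm_le hK u]))
      have := (abs_le.1 h2).1
      linarith
    rw [e, inner_sub_right, inner_add_right, Complex.sub_re, Complex.add_re, him]
    linarith [hST u]
  have hline : ∀ z : ℂ, z.re = x → z ∉ pseudospectrum ε (H + K) := by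
    intro z hz
    have hzx : z - x = (z.im : ℂ) * Complex.I := by
      rw [← hz]; nth_rw 1 [← Complex.re_add_im z]; ring
    refine notMem_pseudospectrum hε (by linarith : ε < g - δ) ?_ ?_
    · rw [hJN, hzx]
      exact isUnit_of_inner_coercive hS (by linarith : 0 < g - δ) (hcoer _)
    · rw [hJN, hzx]
      exact mul_norm_le_of_inner_coercive hS1 (hcoer _)
  have hNcoer : ∀ u, (g - δ) * ‖u‖ ^ 2 ≤ (⟪S u, N u⟫_ℂ).re := by
    intro u
    simpa using hcoer 0 u
  have hmem : ∀ z ∈ spectrum ℂ N, z + x ∈ pseudospectrum ε (H + K) := by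
    intro z hz
    left
    have : H + K = algebraMap ℂ _ (x : ℂ) + N := by rw [hN, hTdef]; abel
    rw [this, spectrum.add_mem_add_iff]
    exact hz
  obtain ⟨z₁, hz₁, hz₁'⟩ : ∃ z ∈ spectrum ℂ N, 0 ≤ z.re := by
    by_contra! hcon
    have := hSneg (re_inner_nonpos_of_spectrum_re_neg hS hS1 (by linarith : 0 < g - δ)
      hNcoer hcon) v
    rw [hTin] at this
    linarith
  obtain ⟨z₂, hz₂, hz₂'⟩ : ∃ z ∈ spectrum ℂ N, z.re ≤ 0 := by
    by_contra! hcon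
    have h1 : ∀ u, 0 ≤ (⟪S u, u⟫_ℂ).re := fun u => by
      have := re_inner_nonpos_of_spectrum_re_neg (S := -S) (N := -N) hS.neg (by simpa using hS1)
        (by linarith : 0 < g - δ) (fun u => by simpa using hNcoer u) (fun z hz => by
          rw [← spectrum.neg_eq, Set.mem_neg] at hz
          have := hcon _ hz
          simp at this
          linarith) u
      simpa using this
    have := hSpos h1 w
    rw [hTin] at this
    linarith
  intro hconn
  have himg := hconn.image Complex.re Complex.continuous_re.continuousOn
  obtain ⟨z, hz, hzx⟩ := himg.Icc_subset (Set.mem_image_of_mem _ (hmem z₂ hz₂))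
    (Set.mem_image_of_mem _ (hmem z₁ hz₁)) (⟨by simpa using hz₂', by simpa using hz₁'⟩ :
      x ∈ Set.Icc (z₂ + x : ℂ).re (z₁ + x : ℂ).re)
  exact hline z hzx hz

end Gap

namespace LinearMap.IsSymmetric
variable {E : Type*} [NormedAddCommGroup E] [InnerProductSpace ℂ E] {n : ℕ}
  {T : E →ₗ[ℂ] E}

lemma disjoint_of_inner_lt {U V : Submodule ℂ E} {α β : ℝ} (hαβ : α < β)
    (hU : ∀ w ∈ U, (⟪T w, w⟫_ℂ).re ≤ α * ‖w‖ ^ 2)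
    (hV : ∀ w ∈ V, β * ‖w‖ ^ 2 ≤ (⟪T w, w⟫_ℂ).re) : Disjoint U V := by
  rw [Submodule.disjoint_def]
  intro w hwU hwV
  by_contra hw
  have : 0 < ‖w‖ ^ 2 := by positivity
  nlinarith [hU w hwU, hV w hwV]

variable [FiniteDimensional ℂ E]

lemma re_inner_apply_self (hT : T.IsSymmetric) (hn : Module.finrank ℂ E = n) (w : E) :
    (⟪T w, w⟫_ℂ).re
      = ∑ i, hT.eigenvalues hn i * ‖(hT.eigenvectorBasis hn).repr w i‖ ^ 2 := by
  rw [← (hT.eigenvectorBasis hn).repr.inner_map_map, PiLp.inner_apply, Complex.re_sum]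
  refine Finset.sum_congr rfl fun i _ => ?_
  rw [hT.eigenvectorBasis_apply_self_apply hn, RCLike.inner_apply, map_mul, Complex.sq_norm,
    Complex.normSq_apply]
  simp
  ring

/-- The span of the eigenvectors with index in `s`. -/
noncomputable def eigenspan (hT : T.IsSymmetric) (hn : Module.finrank ℂ E = n)
    (s : Set (Fin n)) : Submodule ℂ E :=
  Submodule.span ℂ (hT.eigenvectorBasis hn '' s)

lemma repr_eq_zero_of_mem_eigenspan (hT : T.IsSymmetric) (hn : Module.finrank ℂ E = n)
    {s : Set (Fin n)} {w : E} (hw : w ∈ hT.eigenspan hn s) {i : Fin n} (hi : i ∉ s) :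
    (hT.eigenvectorBasis hn).repr w i = 0 := by
  rw [eigenspan, ← OrthonormalBasis.coe_toBasis, Module.Basis.mem_span_image] at hw
  by_contra h
  exact hi (hw (by simpa using h))

lemma finrank_eigenspan (hT : T.IsSymmetric) (hn : Module.finrank ℂ E = n)
    (s : Finset (Fin n)) : Module.finrank ℂ (hT.eigenspan hn s) = s.card := by
  have hli := (hT.eigenvectorBasis hn).orthonormal.linearIndependent
  have := finrank_span_eq_card (hli.comp ((↑) : s → Fin n) Subtype.val_injective)
  rw [Set.range_comp, show Set.range ((↑) : s → Fin n) = ↑s from Subtype.range_coe,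
    Fintype.card_coe] at this
  exact this

lemma le_re_inner_of_mem_eigenspan (hT : T.IsSymmetric) (hn : Module.finrank ℂ E = n)
    {k : Fin n} {w : E} (hw : w ∈ hT.eigenspan hn (Finset.Iic k)) :
    hT.eigenvalues hn k * ‖w‖ ^ 2 ≤ (⟪T w, w⟫_ℂ).re := by
  rw [hT.re_inner_apply_self hn, ← (hT.eigenvectorBasis hn).repr.norm_map,
    EuclideanSpace.norm_sq_eq, Finset.mul_sum]
  refine Finset.sum_le_sum fun i _ => ?_
  by_cases hi : i ≤ k
  · gcongr
    exact hT.eigenvalues_antitone hn hi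
  · rw [hT.repr_eq_zero_of_mem_eigenspan hn hw (by simpa using hi)]
    simp

lemma re_inner_le_of_mem_eigenspan (hT : T.IsSymmetric) (hn : Module.finrank ℂ E = n)
    {k : Fin n} {w : E} (hw : w ∈ hT.eigenspan hn (Finset.Ici k)) :
    (⟪T w, w⟫_ℂ).re ≤ hT.eigenvalues hn k * ‖w‖ ^ 2 := by
  rw [hT.re_inner_apply_self hn, ← (hT.eigenvectorBasis hn).repr.norm_map,
    EuclideanSpace.norm_sq_eq, Finset.mul_sum]
  refine Finset.sum_le_sum fun i _ => ?_
  by_cases hi : k ≤ i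
  · gcongr
    exact hT.eigenvalues_antitone hn hi
  · rw [hT.repr_eq_zero_of_mem_eigenspan hn hw (by simpa using hi)]
    simp

/-- Min-max: complementary-dimensional subspaces on which the form of `T` is at most `x - g`,
respectively at least `x + g`, force a gap in the spectrum of `T`. -/
lemma mul_norm_le_of_finrank (hT : T.IsSymmetric) {x g : ℝ} {U V : Submodule ℂ E}
    (hUV : Module.finrank ℂ E ≤ Module.finrank ℂ U + Module.finrank ℂ V)
    (hU : ∀ w ∈ U, (⟪T w, w⟫_ℂ).re ≤ (x - g) * ‖w‖ ^ 2)
    (hV : ∀ w ∈ V, (x + g) * ‖w‖ ^ 2 ≤ (⟪T w, w⟫_ℂ).re) (hg : 0 < g) (u : E) :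
    g * ‖u‖ ≤ ‖T u - (x : ℂ) • u‖ := by
  obtain ⟨n, hn⟩ : ∃ n, Module.finrank ℂ E = n := ⟨_, rfl⟩
  have hev : ∀ i, g ≤ |hT.eigenvalues hn i - x| := by
    intro i
    by_contra! hi
    obtain ⟨hi1, hi2⟩ := abs_lt.1 hi
    have h1 := Submodule.finrank_add_finrank_le_of_disjoint
      (disjoint_of_inner_lt (by linarith) hU
        (fun w hw => hT.le_re_inner_of_mem_eigenspan hn (k := i) hw))
    have h2 := Submodule.finrank_add_finrank_le_of_disjoint
      (disjoint_of_inner_lt (by linarith)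
        (fun w hw => hT.re_inner_le_of_mem_eigenspan hn (k := i) hw) hV)
    rw [hT.finrank_eigenspan, Fin.card_Iic] at h1
    rw [hT.finrank_eigenspan, Fin.card_Ici] at h2
    omega
  refine le_of_sq_le_sq ?_ (norm_nonneg _)
  rw [mul_pow, ← (hT.eigenvectorBasis hn).repr.norm_map u,
    ← (hT.eigenvectorBasis hn).repr.norm_map (T u - _), EuclideanSpace.norm_sq_eq,
    EuclideanSpace.norm_sq_eq, Finset.mul_sum]
  refine Finset.sum_le_sum fun i _ => ?_
  have e : (hT.eigenvectorBasis hn).repr (T u - (x : ℂ) • u) i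
      = ((hT.eigenvalues hn i - x : ℝ) : ℂ) * (hT.eigenvectorBasis hn).repr u i := by
    rw [map_sub, map_smul, PiLp.sub_apply, PiLp.smul_apply,
      hT.eigenvectorBasis_apply_self_apply hn]
    push_cast
    simp
    ring
  rw [e, norm_mul, mul_pow, Complex.norm_real, Real.norm_eq_abs]
  gcongr
  exact hev i

end LinearMap.IsSymmetric

section Jacobi

/-- The compression to the sites `m + 1, …, m + q` of the real symmetric Jacobi matrix with diagonal
`a` and off-diagonal `h`, the entry `h n` coupling the sites `n` and `n + 1`. -/
def jacobiBlock (a h : ℤ → ℝ) (q : ℕ) (m : ℤ) : Matrix (Fin q) (Fin q) ℂ :=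
  fun i j => (if (i : ℤ) = j + 1 then (h (m + 1 + j) : ℂ) else 0) +
    (if (i : ℤ) = j then (a (m + 1 + j) : ℂ) else 0) +
    (if (i : ℤ) = j - 1 then (h (m + j) : ℂ) else 0)

lemma isSymmetric_jacobiBlock (a h : ℤ → ℝ) (q : ℕ) (m : ℤ) :
    (Matrix.toEuclideanLin (jacobiBlock a h q m)).IsSymmetric := by
  rw [Matrix.isSymmetric_toEuclideanLin_iff]
  ext i j
  rw [Matrix.conjTranspose_apply]
  simp only [jacobiBlock, star_add, apply_ite star, star_zero, Complex.star_def,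
    Complex.conj_ofReal]
  have h1 : (if (j : ℤ) = i + 1 then (h (m + 1 + i) : ℂ) else 0)
      = if (i : ℤ) = j - 1 then (h (m + j) : ℂ) else 0 := by
    by_cases hij : (i : ℤ) = j - 1
    · rw [if_pos hij, if_pos (by lia), hij]; congr 2; ring
    · rw [if_neg hij, if_neg (by lia)]
  have h2 : (if (j : ℤ) = i - 1 then (h (m + i) : ℂ) else 0)
      = if (i : ℤ) = j + 1 then (h (m + 1 + j) : ℂ) else 0 := by
    by_cases hij : (i : ℤ) = j + 1
    · rw [if_pos hij, if_pos (by lia), hij]; congr 2; ring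
    · rw [if_neg hij, if_neg (by lia)]
  have h3 : (if (j : ℤ) = i then (a (m + 1 + i) : ℂ) else 0)
      = if (i : ℤ) = j then (a (m + 1 + j) : ℂ) else 0 := by
    by_cases hij : (i : ℤ) = j
    · rw [if_pos hij, if_pos (by lia), hij]
    · rw [if_neg hij, if_neg (by lia)]
  rw [h1, h2, h3]
  ring

/-- The eigenvalues of `jacobiBlock a h q m` in decreasing order. -/
noncomputable def blockEigenvalue (a h : ℤ → ℝ) (q : ℕ) (m : ℤ) : Fin q → ℝ :=
  (isSymmetric_jacobiBlock a h q m).eigenvalues finrank_euclideanSpace_fin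

lemma sum_blockEigenvalue (a h : ℤ → ℝ) (q : ℕ) (m : ℤ) :
    ∑ k, blockEigenvalue a h q m k = ∑ i ∈ Finset.range q, a (m + 1 + i) := by
  have h1 := (isSymmetric_jacobiBlock a h q m).re_trace_eq_sum_eigenvalues
    finrank_euclideanSpace_fin
  rw [LinearMap.trace_eq_sum_inner _ (EuclideanSpace.basisFun (Fin q) ℂ)] at h1
  rw [Finset.sum_range, blockEigenvalue, ← h1, map_sum]
  refine Finset.sum_congr rfl fun i _ => ?_
  simp [EuclideanSpace.inner_single_left, Matrix.toLpLin_apply, jacobiBlock, eq_sub_iff_add_eq]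

variable {E : Type*} [NormedAddCommGroup E] [InnerProductSpace ℂ E]

/-- The linear map sending the standard basis to the segment `e (m + 1), …, e (m + q)`. -/
noncomputable def segmentMap (e : ℤ → E) (q : ℕ) (m : ℤ) : EuclideanSpace ℂ (Fin q) →ₗ[ℂ] E where
  toFun φ := ∑ i, φ i • e (m + 1 + (i : ℕ))
  map_add' φ ψ := by simp [add_smul, Finset.sum_add_distrib]
  map_smul' c φ := by simp [mul_smul, Finset.smul_sum]

/-- `T` acts on the locally orthonormal sequence `e` as a symmetric Jacobi matrix. -/
structure IsJacobi (a h : ℤ → ℝ) (q : ℕ) (e : ℤ → E) (T : E →ₗ[ℂ] E) : Prop where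
  isSymmetric : T.IsSymmetric
  inner_eq : ∀ k l : ℤ, |k - l| ≤ q → ⟪e k, e l⟫_ℂ = if k = l then 1 else 0
  apply_eq : ∀ k, T (e k) = (h k : ℂ) • e (k + 1) + (a k : ℂ) • e k + (h (k - 1) : ℂ) • e (k - 1)

namespace IsJacobi
variable {a h : ℤ → ℝ} {q : ℕ} {e : ℤ → E} {T : E →ₗ[ℂ] E}

lemma norm_segmentMap (hT : IsJacobi a h q e T) (m : ℤ) (φ : EuclideanSpace ℂ (Fin q)) :
    ‖segmentMap e q m φ‖ = ‖φ‖ := by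
  have ho : Orthonormal ℂ (fun i : Fin q => e (m + 1 + (i : ℕ))) := by
    rw [orthonormal_iff_ite]
    intro i j
    have := i.2
    have := j.2
    rw [hT.inner_eq _ _ (by rw [abs_le]; lia)]
    simp [Fin.ext_iff]
  rw [← sq_eq_sq₀ (norm_nonneg _) (norm_nonneg _), EuclideanSpace.norm_sq_eq,
    ← inner_self_eq_norm_sq (𝕜 := ℂ)]
  refine (congrArg Complex.re (ho.inner_sum φ φ Finset.univ)).trans ?_
  rw [Complex.re_sum]
  refine Finset.sum_congr rfl fun i _ => ?_
  rw [Complex.conj_mul']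
  norm_cast

lemma inner_segmentMap (hT : IsJacobi a h q e T) (m : ℤ) (φ : EuclideanSpace ℂ (Fin q)) :
    ⟪T (segmentMap e q m φ), segmentMap e q m φ⟫_ℂ
      = ⟪Matrix.toEuclideanLin (jacobiBlock a h q m) φ, φ⟫_ℂ := by
  have hentry : ∀ i j : Fin q, ⟪e (m + 1 + (i : ℕ)), T (e (m + 1 + (j : ℕ)))⟫_ℂ
      = jacobiBlock a h q m i j := by
    intro i j
    have := i.2
    have := j.2
    rw [hT.apply_eq, inner_add_right, inner_add_right, inner_smul_right, inner_smul_right,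
      inner_smul_right, hT.inner_eq _ _ (by rw [abs_le]; lia),
      hT.inner_eq _ _ (by rw [abs_le]; lia), hT.inner_eq _ _ (by rw [abs_le]; lia), jacobiBlock]
    simp only [mul_ite, mul_one, mul_zero]
    congr 1
    · congr 1
      · exact if_congr (by lia) rfl rfl
      · exact if_congr (by lia) rfl rfl
    · refine if_congr (by lia) ?_ rfl
      congr 2; ring
  rw [hT.isSymmetric, isSymmetric_jacobiBlock a h q m]
  simp only [segmentMap, LinearMap.coe_mk, AddHom.coe_mk, map_sum, map_smul, sum_inner, inner_sum,
    inner_smul_left, inner_smul_right, hentry, PiLp.inner_apply, Matrix.toLpLin_apply,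
    Matrix.mulVec, dotProduct, RCLike.inner_apply, Finset.sum_mul, Finset.mul_sum]
  rw [Finset.sum_comm]
  refine Finset.sum_congr rfl fun i _ => Finset.sum_congr rfl fun j _ => ?_
  ring

end IsJacobi
end Jacobi

section Bloch

lemma IsJacobi.mul_norm_le {E : Type*} [NormedAddCommGroup E] [InnerProductSpace ℂ E]
    [FiniteDimensional ℂ E] {a h : ℤ → ℝ} {q : ℕ} {e : ℤ → E} {T : E →ₗ[ℂ] E}
    (hT : IsJacobi a h q e T) (hE : Module.finrank ℂ E = q + 1) {m n : ℤ} {k : Fin q} {x g : ℝ}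
    (hg : 0 < g) (hm : blockEigenvalue a h q m k = x - g) (hn : blockEigenvalue a h q n k = x + g)
    (u : E) : g * ‖u‖ ≤ ‖T u - (x : ℂ) • u‖ := by
  have hinj : ∀ m, Function.Injective (segmentMap e q m) := fun m =>
    (injective_iff_map_eq_zero _).2 fun φ hφ => by
      rw [← norm_eq_zero, ← hT.norm_segmentMap m, hφ, norm_zero]
  have hq : Module.finrank ℂ (EuclideanSpace ℂ (Fin q)) = q := finrank_euclideanSpace_fin
  refine hT.isSymmetric.mul_norm_le_of_finrank
    (U := ((isSymmetric_jacobiBlock a h q m).eigenspan hq (Finset.Ici k)).map (segmentMap e q m))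
    (V := ((isSymmetric_jacobiBlock a h q n).eigenspan hq (Finset.Iic k)).map (segmentMap e q n))
    ?_ ?_ ?_ hg u
  · rw [(Submodule.equivMapOfInjective _ (hinj m) _).finrank_eq.symm,
      (Submodule.equivMapOfInjective _ (hinj n) _).finrank_eq.symm,
      LinearMap.IsSymmetric.finrank_eigenspan, LinearMap.IsSymmetric.finrank_eigenspan,
      Fin.card_Ici, Fin.card_Iic, hE]
    have := k.2
    omega
  · rintro _ ⟨φ, hφ, rfl⟩
    rw [hT.inner_segmentMap, hT.norm_segmentMap, ← hm]
    exact (isSymmetric_jacobiBlock a h q m).re_inner_le_of_mem_eigenspan hq hφ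
  · rintro _ ⟨φ, hφ, rfl⟩
    rw [hT.inner_segmentMap, hT.norm_segmentMap, ← hn]
    exact (isSymmetric_jacobiBlock a h q n).le_re_inner_of_mem_eigenspan hq hφ

/-- The Bloch (Floquet) operator of a periodic Jacobi matrix, with quasimomentum `η` distributed
evenly over the period. -/
noncomputable def blochOp (a h : ℤ → ℝ) (q : ℕ) (η : ℂ) :
    EuclideanSpace ℂ (ZMod (q + 1)) →ₗ[ℂ] EuclideanSpace ℂ (ZMod (q + 1)) where
  toFun w := WithLp.toLp 2 fun j => (h (j - 1).val : ℂ) * η⁻¹ * w (j - 1) + (a j.val : ℂ) * w j +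
    (h j.val : ℂ) * η * w (j + 1)
  map_add' v w := by
    ext j
    simp
    ring
  map_smul' c v := by
    ext j
    simp
    ring

/-- The Bloch transform of the unit vector at site `k`. -/
noncomputable def blochVec (q : ℕ) (η : ℂ) (k : ℤ) : EuclideanSpace ℂ (ZMod (q + 1)) :=
  EuclideanSpace.single (k : ZMod (q + 1)) (η ^ (-k))

lemma apply_val_intCast {q : ℕ} {v : ℤ → ℝ} (hv : ∀ n, v (n + (q + 1 : ℕ)) = v n) (k : ℤ) :
    v ((k : ZMod (q + 1)).val : ℤ) = v k := by
  have hper : Function.Periodic v ((q + 1 : ℕ) : ℤ) := hv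
  rw [ZMod.val_intCast, Int.emod_def, mul_comm]
  exact hper.sub_zsmul_eq _

lemma inner_blochVec {q : ℕ} {η : ℂ} (hη : ‖η‖ = 1) (k l : ℤ) :
    ⟪blochVec q η k, blochVec q η l⟫_ℂ
      = if (k : ZMod (q + 1)) = l then η ^ (k - l) else 0 := by
  have hη0 : η ≠ 0 := by rintro rfl; simp at hη
  have hinv : (starRingEnd ℂ) η = η⁻¹ := (Complex.inv_eq_conj hη).symm
  rw [blochVec, blochVec, EuclideanSpace.inner_single_left, map_zpow₀, hinv, inv_zpow', neg_neg]
  by_cases hkl : (k : ZMod (q + 1)) = l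
  · simp [hkl, sub_eq_add_neg, zpow_add₀ hη0]
  · simp [hkl]

lemma isJacobi_bloch {a h : ℤ → ℝ} {q : ℕ} (ha : ∀ n, a (n + (q + 1 : ℕ)) = a n)
    (hh : ∀ n, h (n + (q + 1 : ℕ)) = h n) {η : ℂ} (hη : ‖η‖ = 1) :
    IsJacobi a h q (blochVec q η) (blochOp a h q η) where
  isSymmetric v w := by
    have hinv : (starRingEnd ℂ) η = η⁻¹ := (Complex.inv_eq_conj hη).symm
    simp only [blochOp, LinearMap.coe_mk, AddHom.coe_mk, PiLp.inner_apply, RCLike.inner_apply,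
      map_add, map_mul, Complex.conj_ofReal, hinv, map_inv₀, inv_inv, mul_add, add_mul,
      Finset.sum_add_distrib]
    have e1 := Equiv.sum_comp (Equiv.addRight (1 : ZMod (q + 1))) fun j =>
      w j * ((h (j - 1).val : ℂ) * η * (starRingEnd ℂ) (v (j - 1)))
    have e2 := Equiv.sum_comp (Equiv.addRight (1 : ZMod (q + 1))) fun j =>
      (h (j - 1).val : ℂ) * η⁻¹ * w (j - 1) * (starRingEnd ℂ) (v j)
    rw [← e1, ← e2]
    simp only [Equiv.coe_addRight, add_sub_cancel_right, ← Finset.sum_add_distrib]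
    exact Finset.sum_congr rfl fun j _ => by ring
  inner_eq k l hkl := by
    rw [inner_blochVec hη]
    by_cases h : k = l
    · simp [h]
    · rw [if_neg h, if_neg]
      rw [ZMod.intCast_eq_intCast_iff_dvd_sub]
      intro hd
      have := Int.eq_zero_of_abs_lt_dvd hd (by rw [abs_sub_comm]; push_cast; lia)
      lia
  apply_eq k := by
    have hη0 : η ≠ 0 := by rintro rfl; simp at hη
    ext j
    simp only [blochOp, blochVec, LinearMap.coe_mk, AddHom.coe_mk, PiLp.add_apply, PiLp.smul_apply,
      PiLp.single_apply, smul_eq_mul]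
    congr 1
    · congr 1
      · by_cases hj : j = ((k + 1 : ℤ) : ZMod (q + 1))
        · have h1 : j - 1 = (k : ZMod (q + 1)) := by rw [hj]; push_cast; ring
          rw [if_pos hj, if_pos h1, h1, apply_val_intCast hh, neg_add, zpow_add₀ hη0, zpow_neg_one]
          ring
        · have h1 : j - 1 ≠ (k : ZMod (q + 1)) := fun h1 => hj (by push_cast; rw [← h1]; ring)
          rw [if_neg hj, if_neg h1, mul_zero, mul_zero]
      · by_cases hj : j = (k : ZMod (q + 1))
        · rw [if_pos hj, hj, apply_val_intCast ha]
        · simp [hj]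
    · by_cases hj : j = ((k - 1 : ℤ) : ZMod (q + 1))
      · have h1 : j + 1 = (k : ZMod (q + 1)) := by rw [hj]; push_cast; ring
        rw [if_pos hj, if_pos h1, hj, apply_val_intCast hh,
          show -(k - 1) = 1 + -k by ring, zpow_add₀ hη0, zpow_one]
        ring
      · have h1 : j + 1 ≠ (k : ZMod (q + 1)) := fun h1 => hj (by push_cast; rw [← h1]; ring)
        rw [if_neg hj, if_neg h1, mul_zero, mul_zero]

lemma inner_linearCombination_self {E : Type*} [NormedAddCommGroup E] [InnerProductSpace ℂ E]
    (e : ℤ → E) (x : ℤ →₀ ℂ) :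
    ⟪Finsupp.linearCombination ℂ e x, Finsupp.linearCombination ℂ e x⟫_ℂ
      = ∑ i ∈ x.support, ∑ j ∈ x.support, (starRingEnd ℂ) (x i) * x j * ⟪e i, e j⟫_ℂ := by
  simp only [Finsupp.linearCombination_apply, Finsupp.sum, sum_inner, inner_sum,
    inner_smul_left, inner_smul_right, Finset.mul_sum]
  rw [Finset.sum_comm]
  exact Finset.sum_congr rfl fun i _ => Finset.sum_congr rfl fun j _ => by ring

lemma sum_inner_blochVec (q : ℕ) {N : ℕ} (hN : 0 < N) {ω : ℂ} (hω : IsPrimitiveRoot ω N) {i j : ℤ}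
    (hij : |i - j| < N) :
    ∑ t ∈ Finset.range N, ⟪blochVec q (ω ^ t) i, blochVec q (ω ^ t) j⟫_ℂ
      = N * if i = j then 1 else 0 := by
  have hω1 : ‖ω‖ = 1 := hω.norm'_eq_one hN.ne'
  have hterm : ∀ t : ℕ, ⟪blochVec q (ω ^ t) i, blochVec q (ω ^ t) j⟫_ℂ
      = (if (i : ZMod (q + 1)) = j then 1 else 0) * (ω ^ (i - j)) ^ t := by
    intro t
    rw [inner_blochVec (by rw [norm_pow, hω1, one_pow]), ite_mul, one_mul, zero_mul,
      ← zpow_natCast, ← zpow_natCast, zpow_comm]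
  simp_rw [hterm, ← Finset.mul_sum]
  by_cases h : i = j
  · simp [h]
  · have hne : ω ^ (i - j) ≠ 1 := fun h1 => by
      rw [hω.zpow_eq_one_iff_dvd] at h1
      have := Int.eq_zero_of_abs_lt_dvd h1 hij
      lia
    have hpow : (ω ^ (i - j)) ^ N = 1 := by
      rw [← zpow_natCast, zpow_comm, zpow_natCast, hω.pow_eq_one, one_zpow]
    rw [geom_sum_eq hne, hpow]
    simp [h]

/-- Parseval's identity for the discrete Bloch transform of finitely supported sequences. -/
lemma sum_norm_sq_bloch {E : Type*} [NormedAddCommGroup E] [InnerProductSpace ℂ E] {e : ℤ → E}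
    (he : Orthonormal ℂ e) (q : ℕ) (x : ℤ →₀ ℂ) {N : ℕ} (hN : 0 < N) {ω : ℂ}
    (hω : IsPrimitiveRoot ω N) (hx : ∀ i ∈ x.support, ∀ j ∈ x.support, |i - j| < N) :
    ∑ t ∈ Finset.range N, ‖Finsupp.linearCombination ℂ (blochVec q (ω ^ t)) x‖ ^ 2
      = N * ‖Finsupp.linearCombination ℂ e x‖ ^ 2 := by
  have key : ∑ t ∈ Finset.range N, ⟪Finsupp.linearCombination ℂ (blochVec q (ω ^ t)) x,
      Finsupp.linearCombination ℂ (blochVec q (ω ^ t)) x⟫_ℂ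
      = N * ⟪Finsupp.linearCombination ℂ e x, Finsupp.linearCombination ℂ e x⟫_ℂ := by
    simp only [inner_linearCombination_self]
    rw [Finset.sum_comm, Finset.mul_sum]
    refine Finset.sum_congr rfl fun i hi => ?_
    rw [Finset.sum_comm, Finset.mul_sum]
    refine Finset.sum_congr rfl fun j hj => ?_
    rw [← Finset.mul_sum, sum_inner_blochVec q hN hω (hx i hi j hj), orthonormal_iff_ite.1 he]
    ring
  have := congrArg Complex.re key
  rw [Complex.re_sum, ← Complex.ofReal_natCast, Complex.re_ofReal_mul] at this
  simp only [← inner_self_eq_norm_sq (𝕜 := ℂ)]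
  exact this

lemma exists_forall_abs_sub_lt (s : Finset ℤ) : ∃ N : ℕ, ∀ i ∈ s, ∀ j ∈ s, |i - j| < N := by
  refine ⟨(s ×ˢ s).sup (fun ij => (ij.1 - ij.2).natAbs) + 1, fun i hi j hj => ?_⟩
  have := Finset.le_sup (f := fun ij : ℤ × ℤ => (ij.1 - ij.2).natAbs) (Finset.mk_mem_product hi hj)
  rw [Int.abs_eq_natAbs]
  exact_mod_cast Nat.lt_succ_of_le this

/-- The Jacobi matrix with diagonal `a` and off-diagonal `h` acting on finitely supported
sequences. -/
noncomputable def finsuppJacobi (a h : ℤ → ℝ) : (ℤ →₀ ℂ) →ₗ[ℂ] (ℤ →₀ ℂ) :=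
  Finsupp.linearCombination ℂ fun k => (h k : ℂ) • Finsupp.single (k + 1) (1 : ℂ) +
    (a k : ℂ) • Finsupp.single k (1 : ℂ) + (h (k - 1) : ℂ) • Finsupp.single (k - 1) (1 : ℂ)

lemma IsJacobi.apply_linearCombination {E : Type*} [NormedAddCommGroup E] [InnerProductSpace ℂ E]
    {a h : ℤ → ℝ} {q : ℕ} {e : ℤ → E} {T : E →ₗ[ℂ] E} (hT : IsJacobi a h q e T) (y : ℤ →₀ ℂ) :
    T (Finsupp.linearCombination ℂ e y) = Finsupp.linearCombination ℂ e (finsuppJacobi a h y) := by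
  induction y using Finsupp.induction_linear with
  | zero => simp
  | add y z hy hz => simp only [map_add, hy, hz]
  | single k c =>
    simp only [finsuppJacobi, Finsupp.linearCombination_single, map_smul, map_add, hT.apply_eq,
      one_smul]

/-- If an eigenvalue of the block at `m` lies below the eigenvalue of the same index of the block at
`n`, the interval between them is a gap in the spectrum of the periodic Jacobi operator. -/
lemma mul_norm_le_of_blockEigenvalue {E : Type*} [NormedAddCommGroup E] [InnerProductSpace ℂ E]
    {a h : ℤ → ℝ} {q : ℕ} (ha : ∀ n, a (n + (q + 1 : ℕ)) = a n)
    (hh : ∀ n, h (n + (q + 1 : ℕ)) = h n) {e : ℤ → E} (he : Orthonormal ℂ e)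
    (hdense : Dense (Submodule.span ℂ (Set.range e) : Set E)) {T : E →L[ℂ] E}
    (hT : IsJacobi a h q e T.toLinearMap) {m n : ℤ} {k : Fin q} {x g : ℝ}
    (hg : 0 < g) (hm : blockEigenvalue a h q m k = x - g) (hn : blockEigenvalue a h q n k = x + g)
    (u : E) : g * ‖u‖ ≤ ‖T u - (x : ℂ) • u‖ := by
  have hclosed : IsClosed {u : E | g * ‖u‖ ≤ ‖T u - (x : ℂ) • u‖} :=
    isClosed_le (by fun_prop) (by fun_prop)
  refine hclosed.closure_subset_iff.2 (fun u hu => ?_) (hdense u)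
  obtain ⟨y, rfl⟩ := (Finsupp.mem_span_range_iff_exists_finsupp).1 hu
  obtain ⟨N, hN⟩ := exists_forall_abs_sub_lt
    (y.support ∪ (finsuppJacobi a h y - (x : ℂ) • y).support)
  have hω := Complex.isPrimitiveRoot_exp (N + 1) N.succ_ne_zero
  have hN' : ∀ s ⊆ y.support ∪ (finsuppJacobi a h y - (x : ℂ) • y).support,
      ∀ i ∈ s, ∀ j ∈ s, |i - j| < (N + 1 : ℕ) := fun s hs i hi j hj =>
    (hN i (hs hi) j (hs hj)).trans (by exact_mod_cast N.lt_succ_self)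
  have hy := sum_norm_sq_bloch he q y N.succ_pos hω (hN' _ Finset.subset_union_left)
  have hz := sum_norm_sq_bloch he q _ N.succ_pos hω (hN' _ Finset.subset_union_right)
  have hle : g ^ 2 * ∑ t ∈ Finset.range (N + 1), ‖Finsupp.linearCombination ℂ
        (blochVec q (Complex.exp (2 * Real.pi * Complex.I / (N + 1 : ℕ)) ^ t)) y‖ ^ 2
      ≤ ∑ t ∈ Finset.range (N + 1), ‖Finsupp.linearCombination ℂ
        (blochVec q (Complex.exp (2 * Real.pi * Complex.I / (N + 1 : ℕ)) ^ t))
        (finsuppJacobi a h y - (x : ℂ) • y)‖ ^ 2 := by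
    rw [Finset.mul_sum]
    refine Finset.sum_le_sum fun t _ => ?_
    have hJ := isJacobi_bloch (q := q) ha hh
      (η := Complex.exp (2 * Real.pi * Complex.I / (N + 1 : ℕ)) ^ t)
      (by rw [norm_pow, hω.norm'_eq_one N.succ_ne_zero, one_pow])
    rw [map_sub, map_smul, ← hJ.apply_linearCombination, ← mul_pow]
    exact pow_le_pow_left₀ (by positivity)
      (hJ.mul_norm_le (by simp [ZMod.card]) hg hm hn _) 2
  rw [hy, hz, map_sub, map_smul, ← hT.apply_linearCombination, mul_left_comm, ← mul_pow] at hle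
  exact le_of_sq_le_sq (le_of_mul_le_mul_left hle (by positivity)) (norm_nonneg _)

end Bloch

section Sequences

lemma apply_emod {p : ℕ} {v : ℤ → ℝ} (hv : ∀ n, v (n + p) = v n) (n : ℤ) : v (n % p) = v n := by
  have hper : Function.Periodic v (p : ℤ) := hv
  rw [Int.emod_def, mul_comm]
  exact hper.sub_zsmul_eq _

lemma le_iSup_fin_of_periodic {p : ℕ} (hp : 0 < p) {v : ℤ → ℝ} (hv : ∀ n, v (n + p) = v n) (n : ℤ) :
    v n ≤ ⨆ i : Fin p, v ((i : ℕ) : ℤ) := by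
  have h0 : 0 ≤ n % p := Int.emod_nonneg _ (by lia)
  have h1 : n % p < p := Int.emod_lt_of_pos _ (by lia)
  have := le_ciSup (f := fun i : Fin p => v ((i : ℕ) : ℤ)) (Set.finite_range _).bddAbove
    ⟨(n % p).toNat, by lia⟩
  simpa only [Int.toNat_of_nonneg h0, apply_emod hv] using this

lemma sum_range_periodic_eq {p : ℕ} {v : ℤ → ℝ} (hv : ∀ n, v (n + p) = v n) (m : ℤ) :
    ∑ i ∈ Finset.range p, v (m + i) = ∑ i ∈ Finset.range p, v i := by
  have step : ∀ m : ℤ, ∑ i ∈ Finset.range p, v (m + 1 + i) = ∑ i ∈ Finset.range p, v (m + i) := by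
    intro m
    have h1 := Finset.sum_range_succ' (fun i : ℕ => v (m + i)) p
    rw [Finset.sum_range_succ, hv] at h1
    simp only [Nat.cast_add, Nat.cast_one, Nat.cast_zero, add_zero] at h1
    rw [add_right_cancel h1]
    exact Finset.sum_congr rfl fun i _ => congrArg v (by ring)
  induction m using Int.induction_on with
  | zero => simp
  | succ n ih => rw [step, ih]
  | pred n ih => rw [← ih, ← step, sub_add_cancel]

/-- The standard unit vectors of `ℓ²(ℤ)`. -/
noncomputable def unitVec (k : ℤ) : lp (fun _ : ℤ => ℂ) 2 := lp.single 2 k (1 : ℂ)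

lemma inner_unitVec (k : ℤ) (u : lp (fun _ : ℤ => ℂ) 2) : ⟪unitVec k, u⟫_ℂ = u k := by
  rw [unitVec, lp.inner_single_left]
  simp

lemma unitVec_apply (k n : ℤ) : unitVec k n = if n = k then 1 else 0 := by
  rw [unitVec, lp.single_apply, Pi.single_apply]

lemma orthonormal_unitVec : Orthonormal ℂ unitVec := by
  rw [orthonormal_iff_ite]
  intro i j
  rw [inner_unitVec, unitVec_apply]

lemma dense_span_unitVec :
    Dense (Submodule.span ℂ (Set.range unitVec) : Set (lp (fun _ : ℤ => ℂ) 2)) := by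
  intro u
  refine mem_closure_of_tendsto (lp.hasSum_single (by norm_num) u) (.of_forall fun s => ?_)
  refine Submodule.sum_mem _ fun k _ => ?_
  have : lp.single 2 k (u k) = u k • unitVec k := by
    rw [unitVec, ← lp.single_smul, smul_eq_mul, mul_one]
  rw [this]
  exact Submodule.smul_mem _ _ (Submodule.subset_span ⟨k, rfl⟩)

lemma hasSum_norm_sq (u : lp (fun _ : ℤ => ℂ) 2) : HasSum (fun n => ‖u n‖ ^ 2) (‖u‖ ^ 2) := by
  have := lp.hasSum_norm (p := 2) (by norm_num) u
  simpa using this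

variable {a b c : ℤ → ℝ} {J : lp (fun _ : ℤ => ℂ) 2 →L[ℂ] lp (fun _ : ℤ => ℂ) 2}

lemma apply_unitVec (hJ : ∀ u : lp (fun _ : ℤ => ℂ) 2, ∀ n : ℤ,
      J u n = (c (n - 1) : ℂ) * u (n - 1) + (a n : ℂ) * u n + (b n : ℂ) * u (n + 1)) (k : ℤ) :
    J (unitVec k) = (c k : ℂ) • unitVec (k + 1) + (a k : ℂ) • unitVec k +
      (b (k - 1) : ℂ) • unitVec (k - 1) := by
  ext n
  simp only [hJ, lp.coeFn_add, lp.coeFn_smul, Pi.add_apply, Pi.smul_apply, unitVec_apply,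
    smul_eq_mul]
  congr 1
  · congr 1
    · by_cases h : n = k + 1
      · subst h; simp
      · rw [if_neg h, if_neg (by lia), mul_zero, mul_zero]
    · by_cases h : n = k
      · subst h; simp
      · rw [if_neg h, mul_zero, mul_zero]
  · by_cases h : n = k - 1
    · subst h; simp
    · rw [if_neg h, if_neg (by lia), mul_zero, mul_zero]

lemma adjoint_apply (hJ : ∀ u : lp (fun _ : ℤ => ℂ) 2, ∀ n : ℤ,
      J u n = (c (n - 1) : ℂ) * u (n - 1) + (a n : ℂ) * u n + (b n : ℂ) * u (n + 1))
    (u : lp (fun _ : ℤ => ℂ) 2) (n : ℤ) :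
    ContinuousLinearMap.adjoint J u n
      = (b (n - 1) : ℂ) * u (n - 1) + (a n : ℂ) * u n + (c n : ℂ) * u (n + 1) := by
  rw [← inner_unitVec, ContinuousLinearMap.adjoint_inner_right, apply_unitVec hJ, inner_add_left,
    inner_add_left, inner_smul_left, inner_smul_left, inner_smul_left, inner_unitVec,
    inner_unitVec, inner_unitVec, Complex.conj_ofReal, Complex.conj_ofReal, Complex.conj_ofReal]
  ring

lemma isJacobi_add_adjoint (hJ : ∀ u : lp (fun _ : ℤ => ℂ) 2, ∀ n : ℤ,
      J u n = (c (n - 1) : ℂ) * u (n - 1) + (a n : ℂ) * u n + (b n : ℂ) * u (n + 1)) (q : ℕ) :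
    IsJacobi a (fun n => (b n + c n) / 2) q unitVec
      (((1 / 2 : ℝ) : ℂ) • (J + ContinuousLinearMap.adjoint J)).toLinearMap where
  isSymmetric u v := by
    simp only [ContinuousLinearMap.coe_coe, smul_apply,
      add_apply, inner_smul_left, inner_smul_right, inner_add_left,
      inner_add_right, ContinuousLinearMap.adjoint_inner_left,
      ContinuousLinearMap.adjoint_inner_right, Complex.conj_ofReal]
    ring
  inner_eq k l _ := orthonormal_iff_ite.1 orthonormal_unitVec k l
  apply_eq k := by
    have hadj : ContinuousLinearMap.adjoint J (unitVec k)
        = (b k : ℂ) • unitVec (k + 1) + (a k : ℂ) • unitVec k +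
          (c (k - 1) : ℂ) • unitVec (k - 1) :=
      apply_unitVec (a := a) (b := c) (c := b) (adjoint_apply hJ) k
    simp only [ContinuousLinearMap.coe_coe, smul_apply,
      add_apply, hadj, apply_unitVec hJ]
    push_cast
    module

lemma norm_sub_adjoint_le (hJ : ∀ u : lp (fun _ : ℤ => ℂ) 2, ∀ n : ℤ,
      J u n = (c (n - 1) : ℂ) * u (n - 1) + (a n : ℂ) * u n + (b n : ℂ) * u (n + 1))
    {δ : ℝ} (hδ : ∀ n, |c n - b n| ≤ δ) :
    ‖((1 / 2 : ℝ) : ℂ) • (J - ContinuousLinearMap.adjoint J)‖ ≤ δ := by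
  have hδ0 : 0 ≤ δ := (abs_nonneg _).trans (hδ 0)
  refine ContinuousLinearMap.opNorm_le_bound _ hδ0 fun u => ?_
  refine le_of_sq_le_sq ?_ (by positivity)
  have hl := (Equiv.hasSum_iff (Equiv.subRight (1 : ℤ))).2 (hasSum_norm_sq u)
  have hr := (Equiv.hasSum_iff (Equiv.addRight (1 : ℤ))).2 (hasSum_norm_sq u)
  have hsum := (hl.add hr).mul_left (δ ^ 2 / 2)
  refine (hasSum_le (fun n => ?_) (hasSum_norm_sq _) hsum).trans (by rw [mul_pow]; linarith)
  have happ : (((1 / 2 : ℝ) : ℂ) • (J - ContinuousLinearMap.adjoint J)) u n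
      = (((c (n - 1) - b (n - 1)) / 2 : ℝ) : ℂ) * u (n - 1) -
        (((c n - b n) / 2 : ℝ) : ℂ) * u (n + 1) := by
    simp only [smul_apply, sub_apply, lp.coeFn_smul,
      lp.coeFn_sub, Pi.smul_apply, Pi.sub_apply, hJ, adjoint_apply hJ, smul_eq_mul]
    push_cast
    ring
  have hcoef : ∀ n, ∀ w : ℂ, ‖(((c n - b n) / 2 : ℝ) : ℂ) * w‖ ≤ δ / 2 * ‖w‖ := fun n w => by
    rw [norm_mul, Complex.norm_real, Real.norm_eq_abs, abs_div, abs_two]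
    have := hδ n
    gcongr
  have hle := (norm_sub_le _ _).trans (add_le_add (hcoef (n - 1) (u (n - 1))) (hcoef n (u (n + 1))))
  rw [← happ] at hle
  simp only [Function.comp_apply, Equiv.subRight_apply, Equiv.coe_addRight]
  calc _ ≤ (δ / 2 * ‖u (n - 1)‖ + δ / 2 * ‖u (n + 1)‖) ^ 2 := by gcongr
    _ ≤ _ := by nlinarith [mul_nonneg (sq_nonneg δ) (sq_nonneg (‖u (n - 1)‖ - ‖u (n + 1)‖))]

end Sequences

lemma IsJacobi.exists_inner_eq_blockEigenvalue {E : Type*} [NormedAddCommGroup E]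
    [InnerProductSpace ℂ E] {a h : ℤ → ℝ} {q : ℕ} {e : ℤ → E} {T : E →ₗ[ℂ] E}
    (hT : IsJacobi a h q e T) (m : ℤ) (k : Fin q) :
    ∃ v : E, ‖v‖ = 1 ∧ (⟪T v, v⟫_ℂ).re = blockEigenvalue a h q m k := by
  have hsymm := isSymmetric_jacobiBlock a h q m
  have hq : Module.finrank ℂ (EuclideanSpace ℂ (Fin q)) = q := finrank_euclideanSpace_fin
  have hnorm := (hsymm.eigenvectorBasis hq).orthonormal.1 k
  refine ⟨segmentMap e q m (hsymm.eigenvectorBasis hq k), ?_, ?_⟩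
  · rw [hT.norm_segmentMap, hnorm]
  · rw [hT.inner_segmentMap, hsymm.apply_eigenvectorBasis hq, inner_smul_left,
      inner_self_eq_norm_sq_to_K, hnorm]
    simp [blockEigenvalue]

theorem osc_le_of_pseudospectrum_pathConnected_general
    (p : ℕ) (hp : 2 ≤ p) (a b c : ℤ → ℝ)
    (ha : ∀ n : ℤ, a (n + p) = a n) (hb : ∀ n : ℤ, b (n + p) = b n)
    (hc : ∀ n : ℤ, c (n + p) = c n)
    (J : lp (fun _ : ℤ => ℂ) 2 →L[ℂ] lp (fun _ : ℤ => ℂ) 2)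
    (hJ : ∀ u : lp (fun _ : ℤ => ℂ) 2, ∀ n : ℤ,
      J u n = (c (n - 1) : ℂ) * u (n - 1) + (a n : ℂ) * u n + (b n : ℂ) * u (n + 1))
    (ε : ℝ) (hε : 0 < ε) (hconn : IsPathConnected (pseudospectrum ε J)) :
    osc p a ≤ 2 * (ε + ⨆ i : Fin p, |c ((i : ℕ) : ℤ) - b ((i : ℕ) : ℤ)|) * ((p : ℝ) - 1) := by
  obtain ⟨q, rfl⟩ : ∃ q, p = q + 1 := ⟨p - 1, by lia⟩
  set δ := ⨆ i : Fin (q + 1), |c ((i : ℕ) : ℤ) - b ((i : ℕ) : ℤ)| with hδ_def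
  have hδ : ∀ n, |c n - b n| ≤ δ :=
    le_iSup_fin_of_periodic (v := fun n => |c n - b n|) q.succ_pos fun n => by rw [hb, hc]
  set h : ℤ → ℝ := fun n => (b n + c n) / 2 with hh_def
  have hh : ∀ n, h (n + (q + 1 : ℕ)) = h n := fun n => by simp only [hh_def, hb, hc]
  have hT := isJacobi_add_adjoint hJ q
  set H := ((1 / 2 : ℝ) : ℂ) • (J + ContinuousLinearMap.adjoint J) with hH_def
  have hH : IsSelfAdjoint H := ContinuousLinearMap.isSelfAdjoint_iff_isSymmetric.2 hT.isSymmetric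
  have hsplit : J = H + ((1 / 2 : ℝ) : ℂ) • (J - ContinuousLinearMap.adjoint J) := by
    rw [hH_def]
    push_cast
    module
  have heig : ∀ m n k, blockEigenvalue a h q n k - blockEigenvalue a h q m k ≤ 2 * (ε + δ) := by
    intro m n k
    by_contra! hlt
    obtain ⟨v, hv1, hv⟩ := hT.exists_inner_eq_blockEigenvalue n k
    obtain ⟨w, hw1, hw⟩ := hT.exists_inner_eq_blockEigenvalue m k
    have hr : 0 ≤ ε + δ := add_nonneg hε.le ((abs_nonneg _).trans (hδ 0))
    have hgap := mul_norm_le_of_blockEigenvalue ha hh orthonormal_unitVec dense_span_unitVec hT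
      (x := (blockEigenvalue a h q n k + blockEigenvalue a h q m k) / 2)
      (g := (blockEigenvalue a h q n k - blockEigenvalue a h q m k) / 2)
      (by linarith) (m := m) (n := n) (k := k) (by ring) (by ring)
    refine not_isPreconnected_pseudospectrum hH hε (norm_sub_adjoint_le hJ hδ) (by linarith) hgap
      (v := v) (w := w) ?_ ?_ (hsplit ▸ hconn.isConnected.isPreconnected)
    · rw [hv1]
      refine lt_of_lt_of_eq ?_ hv.symm
      linarith
    · rw [hw1]
      refine lt_of_eq_of_lt hw ?_
      linarith
  have hdiff : ∀ m n, a m - a n ≤ 2 * (ε + δ) * q := by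
    intro m n
    have hper := (sum_range_periodic_eq ha m).trans (sum_range_periodic_eq ha n).symm
    rw [Finset.sum_range_succ', Finset.sum_range_succ'] at hper
    have hblock : ∀ m : ℤ, ∑ i ∈ Finset.range q, a (m + (i + 1 : ℕ))
        = ∑ k, blockEigenvalue a h q m k := fun m => by
      rw [sum_blockEigenvalue]
      exact Finset.sum_congr rfl fun i _ => congrArg a (by push_cast; ring)
    rw [hblock, hblock] at hper
    simp only [Nat.cast_zero, add_zero] at hper
    have hle := Finset.sum_le_sum fun k (_ : k ∈ Finset.univ) => heig m n k
    rw [Finset.sum_sub_distrib, Finset.sum_const, Finset.card_univ, Fintype.card_fin,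
      nsmul_eq_mul] at hle
    linarith
  refine ciSup_le fun i => ciSup_le fun j => ?_
  push_cast
  rw [add_sub_cancel_right, abs_le]
  exact ⟨by linarith [hdiff j i], hdiff i j⟩
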